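/- Let φ₁ and Φ₁ denote the standard normal density and distribution function on ℝ, let ν ≥ 1 be an integer, H_ν the ν-th (probabilists') Hermite polynomial, u_ν the maximum real root of H_ν, and h̄_ν(u) = H_{ν−1}(u) φ₁(u)/Φ₁(u). Fix K ≥ 0 and for each d ≥ 3 set η = K/√(log d), Λ(u) = Φ₁(u)/Φ₁(u + 2η), F_ν(x) = ∑_{j=1}^d h̄_ν(x_j) Λ(x_j) and G(x) = ∏_{k=1}^d Φ₁(x_k + 2η) for x ∈ ℝ^d. Then for every β > 0 there exist a constant C > 0 and d₀ ≥ 3 (depending on K, ν, β) such that for all d ≥ d₀: sup_{x∈[u_ν,∞)^d} F_ν(x)^β G(x) ≤ C (log d)^{βν/2}. -/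

import Mathlib

open MeasureTheory Real Polynomial

noncomputable section

/-- The standard normal density on `ℝ`. -/
def gaussD (u : ℝ) : ℝ := (Real.sqrt (2 * π))⁻¹ * Real.exp (-u ^ 2 / 2)

/-- The standard normal distribution function on `ℝ`. -/
def gaussCdf (u : ℝ) : ℝ := ∫ t in Set.Iic u, gaussD t

/-- The `ν`-th (probabilists') Hermite polynomial, evaluated at a real number. -/
def hermiteR (ν : ℕ) (u : ℝ) : ℝ := Polynomial.aeval u (Polynomial.hermite ν)

/-- `h̄_ν(u) = H_{ν-1}(u) φ₁(u) / Φ₁(u)`. -/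
def hbar (ν : ℕ) (u : ℝ) : ℝ := hermiteR (ν - 1) u * gaussD u / gaussCdf u

lemma gaussD_eq : gaussD = ProbabilityTheory.gaussianPDFReal 0 1 := by
  funext u
  simp [gaussD, ProbabilityTheory.gaussianPDFReal]

lemma gaussD_pos (u : ℝ) : 0 < gaussD u := by
  unfold gaussD; positivity

lemma gaussD_int : Integrable gaussD := by
  rw [gaussD_eq]; exact ProbabilityTheory.integrable_gaussianPDFReal 0 1

lemma gaussD_integral : ∫ t, gaussD t = 1 := by
  rw [gaussD_eq]; exact ProbabilityTheory.integral_gaussianPDFReal_eq_one 0 one_ne_zero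

lemma one_sub_cdf (y : ℝ) : 1 - gaussCdf y = ∫ t in Set.Ioi y, gaussD t := by
  have h := integral_add_compl (measurableSet_Iic (a := y)) gaussD_int
  rw [gaussD_integral, Set.compl_Iic] at h
  unfold gaussCdf
  linarith

lemma gaussCdf_nonneg (y : ℝ) : 0 ≤ gaussCdf y :=
  integral_nonneg fun t => (gaussD_pos t).le

lemma gaussCdf_mono {x y : ℝ} (h : x ≤ y) : gaussCdf x ≤ gaussCdf y :=
  setIntegral_mono_set gaussD_int.integrableOn
    (Filter.Eventually.of_forall fun t => (gaussD_pos t).le)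
    (Set.Iic_subset_Iic.2 h).eventuallyLE

lemma gaussCdf_pos (y : ℝ) : 0 < gaussCdf y := by
  unfold gaussCdf
  rw [setIntegral_pos_iff_support_of_nonneg_ae
    (Filter.Eventually.of_forall fun t => (gaussD_pos t).le) gaussD_int.integrableOn]
  have : Function.support gaussD = Set.univ := by
    ext t; simp [(gaussD_pos t).ne']
  simp [this]

lemma mills (y : ℝ) : gaussD y ≤ Real.exp (3 / 2) * (1 + |y|) * (1 - gaussCdf y) := by
  set δ : ℝ := 1 / (1 + |y|) with hδ
  have hy := abs_nonneg y
  have hδ0 : 0 < δ := by positivity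
  have hδm : δ * (1 + |y|) = 1 := by rw [hδ]; field_simp
  have h1 : ∫ t in Set.Ioc y (y + δ), gaussD y * Real.exp (-(3 / 2)) ≤
      ∫ t in Set.Ioc y (y + δ), gaussD t := by
    refine setIntegral_mono_on (integrableOn_const (by simp)) gaussD_int.integrableOn measurableSet_Ioc ?_
    intro t ht
    unfold gaussD
    rw [mul_assoc, ← Real.exp_add]
    refine mul_le_mul_of_nonneg_left (Real.exp_le_exp.2 ?_) (by positivity)
    have ha : t - y ≤ δ := by linarith [ht.2]
    have hb : 0 ≤ t - y := by linarith [ht.1]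
    have h3 : y * (t - y) ≤ |y| * δ :=
      (mul_le_mul_of_nonneg_right (le_abs_self y) hb).trans
        (mul_le_mul_of_nonneg_left ha hy)
    have h4 : (t - y) ^ 2 ≤ 1 := by
      have : δ ≤ 1 := by nlinarith
      nlinarith
    nlinarith
  have h2 : ∫ t in Set.Ioc y (y + δ), gaussD t ≤ ∫ t in Set.Ioi y, gaussD t :=
    setIntegral_mono_set gaussD_int.integrableOn
      (Filter.Eventually.of_forall fun t => (gaussD_pos t).le)
      (Set.Ioc_subset_Ioi_self).eventuallyLE
  rw [← one_sub_cdf] at h2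
  have h3 : ∫ t in Set.Ioc y (y + δ), gaussD y * Real.exp (-(3 / 2)) =
      δ * (gaussD y * Real.exp (-(3 / 2))) := by
    simp [hδ0.le]
  rw [h3] at h1
  have h5 := mul_le_mul_of_nonneg_left (h1.trans h2)
    (show 0 ≤ Real.exp (3 / 2) * (1 + |y|) by positivity)
  have h6 : Real.exp (3 / 2) * (1 + |y|) * (δ * (gaussD y * Real.exp (-(3 / 2)))) =
      gaussD y := by
    have : Real.exp (3 / 2) * Real.exp (-(3 / 2)) = 1 := by
      rw [← Real.exp_add]; simp
    calc _ = (δ * (1 + |y|)) * (Real.exp (3 / 2) * Real.exp (-(3 / 2))) * gaussD y := by ring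
      _ = _ := by rw [hδm, this]; ring
  rwa [h6] at h5

lemma hermite_bound (n : ℕ) : ∃ B : ℝ, 0 < B ∧ ∀ x, |hermiteR n x| ≤ B * (1 + |x|) ^ n := by
  refine ⟨1 + ∑ i ∈ Finset.range (n + 1), |(((Polynomial.hermite n).coeff i : ℤ) : ℝ)|,
    by positivity, fun x => ?_⟩
  unfold hermiteR
  have hx := abs_nonneg x
  rw [Polynomial.aeval_eq_sum_range, Polynomial.natDegree_hermite]
  refine (Finset.abs_sum_le_sum_abs _ _).trans ?_
  rw [add_mul, Finset.sum_mul]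
  refine le_add_of_nonneg_of_le (by positivity) (Finset.sum_le_sum fun i hi => ?_)
  rw [zsmul_eq_mul, abs_mul, abs_pow]
  refine mul_le_mul_of_nonneg_left ?_ (abs_nonneg _)
  calc |x| ^ i ≤ (1 + |x|) ^ i := pow_le_pow_left₀ hx (by linarith) _
    _ ≤ (1 + |x|) ^ n := pow_le_pow_right₀ (by linarith)
      (by have := Finset.mem_range.1 hi; omega)

lemma gaussD_le (x : ℝ) : gaussD x ≤ Real.exp (-x ^ 2 / 2) := by
  unfold gaussD
  refine mul_le_of_le_one_left (by positivity) (inv_le_one_of_one_le₀ ?_)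
  rw [Real.one_le_sqrt]
  linarith [Real.pi_gt_three]

/-- bound of a single summand -/
lemma term_bound (K : ℝ) (hK : 0 ≤ K) (n : ℕ) : ∃ C : ℝ, 0 < C ∧ ∀ s : ℝ, 1 ≤ s → ∀ x : ℝ,
    |hermiteR n x| * gaussD x ≤
      C * (s ^ (n + 1) * (1 - gaussCdf (x + 2 * (K / s))) + Real.exp (-s ^ 2)) := by
  obtain ⟨B, hB, hH⟩ := hermite_bound n
  set C1 : ℝ := B * 3 ^ n * (Real.exp (4 * K + 2 * K ^ 2) * (Real.exp (3 / 2) * (3 + 2 * K)))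
    with hC1
  set C2 : ℝ := B * (n.factorial * Real.exp 2) with hC2
  have hC1p : 0 < C1 := by positivity
  have hC2p : 0 < C2 := by positivity
  refine ⟨C1 + C2, by positivity, fun s hs x => ?_⟩
  have hs0 : 0 < s := by linarith
  set y := x + 2 * (K / s) with hy
  have hp : 0 ≤ 1 - gaussCdf y := by
    rw [one_sub_cdf]; exact integral_nonneg fun t => (gaussD_pos t).le
  set p := 1 - gaussCdf y with hpdef
  have hax := abs_nonneg x
  have hηK : K / s ≤ K := div_le_self hK hs
  have hη0 : 0 ≤ K / s := by positivity
  have hA : 0 ≤ s ^ (n + 1) * p := by positivity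
  have hE := Real.exp_pos (-s ^ 2)
  by_cases hx : |x| ≤ 2 * s
  · have e1 : |hermiteR n x| ≤ B * 3 ^ n * s ^ n := by
      refine (hH x).trans ?_
      rw [mul_assoc, ← mul_pow]
      gcongr
      linarith
    have e2 : gaussD x ≤ Real.exp (4 * K + 2 * K ^ 2) * gaussD y := by
      unfold gaussD
      rw [mul_left_comm, ← Real.exp_add]
      refine mul_le_mul_of_nonneg_left (Real.exp_le_exp.2 ?_) (by positivity)
      have h1 : K / s * x ≤ 2 * K := by
        have : K / s * x ≤ K / s * (2 * s) :=
          mul_le_mul_of_nonneg_left ((le_abs_self x).trans hx) hη0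
        have h2 : K / s * (2 * s) = 2 * K := by field_simp
        linarith
      have h2 : (K / s) ^ 2 ≤ K ^ 2 := by gcongr
      rw [hy]
      nlinarith
    have e3 : gaussD y ≤ Real.exp (3 / 2) * ((3 + 2 * K) * s) * p := by
      refine (mills y).trans ?_
      gcongr
      have : |y| ≤ |x| + 2 * (K / s) := by
        rw [hy]
        refine (abs_add_le _ _).trans ?_
        rw [abs_of_nonneg (show 0 ≤ 2 * (K / s) by positivity)]
      nlinarith
    calc |hermiteR n x| * gaussD x
        ≤ (B * 3 ^ n * s ^ n) * (Real.exp (4 * K + 2 * K ^ 2) *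
          (Real.exp (3 / 2) * ((3 + 2 * K) * s) * p)) := by
          refine mul_le_mul e1 (e2.trans ?_) (gaussD_pos x).le (by positivity)
          gcongr
      _ = C1 * (s ^ (n + 1) * p) := by rw [hC1]; ring
      _ ≤ _ := by nlinarith [mul_nonneg hC2p.le hA, mul_pos hC1p hE, mul_pos hC2p hE]
  · push Not at hx
    have hx2 : 4 * s ^ 2 ≤ x ^ 2 := by
      rw [← sq_abs x]; nlinarith
    have e1 : (1 + |x|) ^ n ≤ n.factorial * Real.exp (1 + |x|) := by
      have := Real.pow_div_factorial_le_exp (1 + |x|) (by positivity) n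
      rwa [div_le_iff₀' (by positivity)] at this
    calc |hermiteR n x| * gaussD x
        ≤ (B * (n.factorial * Real.exp (1 + |x|))) * Real.exp (-x ^ 2 / 2) := by
          refine mul_le_mul ((hH x).trans ?_) (gaussD_le x) (gaussD_pos x).le (by positivity)
          gcongr
      _ = B * n.factorial * Real.exp (1 + |x| + -x ^ 2 / 2) := by
          rw [Real.exp_add (1 + |x|)]; ring
      _ ≤ B * n.factorial * Real.exp (2 + -s ^ 2) := by
          refine mul_le_mul_of_nonneg_left (Real.exp_le_exp.2 ?_) (by positivity)
          rw [← sq_abs x] at *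
          nlinarith [sq_nonneg (|x| - 2)]
      _ = C2 * Real.exp (-s ^ 2) := by rw [Real.exp_add, hC2]; ring
      _ ≤ _ := by nlinarith [mul_nonneg hC2p.le hA, mul_nonneg hC1p.le hA, mul_pos hC1p hE]

/-- **Lemma 7: bound for `sup_{x ∈ [u_ν,∞)^d} F_ν(x)^β G(x)`.** -/
theorem Fnu_pow_G_bound
    (K : ℝ) (hK : 0 ≤ K) (ν : ℕ) (hν : 1 ≤ ν)
    (uν : ℝ) (huν : IsGreatest {u : ℝ | hermiteR ν u = 0} uν)
    (β : ℝ) (hβ : 0 < β) :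
    ∃ C : ℝ, 0 < C ∧ ∃ d₀ : ℕ, 3 ≤ d₀ ∧
      ∀ (d : ℕ), d₀ ≤ d →
      ∀ x : Fin d → ℝ, (∀ j, uν ≤ x j) →
        (∑ j, hbar ν (x j) *
            (gaussCdf (x j) / gaussCdf (x j + 2 * (K / Real.sqrt (Real.log d))))) ^ β *
          ∏ k, gaussCdf (x k + 2 * (K / Real.sqrt (Real.log d))) ≤
        C * (Real.log d) ^ (β * ν / 2) := by
  obtain ⟨C, hC, hT⟩ := term_bound K hK (ν - 1)
  have hν' : ν - 1 + 1 = ν := by omega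
  rw [hν'] at hT
  set c := gaussCdf uν with hc
  have hc0 : 0 < c := gaussCdf_pos uν
  set N := ⌈β⌉₊ with hN
  refine ⟨(C / c) ^ β * (N.factorial * Real.exp 1), by positivity, 3, le_rfl, ?_⟩
  intro d hd x hx
  have hd3 : (3 : ℝ) ≤ d := by exact_mod_cast hd
  have hd0 : (0 : ℝ) < d := by linarith
  have hL : 1 ≤ Real.log d := by
    rw [Real.le_log_iff_exp_le hd0]
    linarith [Real.exp_one_lt_d9]
  set s := Real.sqrt (Real.log d) with hs
  have hs1 : 1 ≤ s := Real.one_le_sqrt.2 hL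
  have hs0 : 0 < s := by linarith
  have hss : s ^ 2 = Real.log d := Real.sq_sqrt (by linarith)
  have hexp : Real.exp (-s ^ 2) = 1 / d := by
    rw [hss, Real.exp_neg, Real.exp_log hd0, one_div]
  set y : Fin d → ℝ := fun j => x j + 2 * (K / s) with hy
  have hη : 0 ≤ 2 * (K / s) := by positivity
  set S := ∑ j, (1 - gaussCdf (y j)) with hS
  have hp : ∀ j, 0 ≤ 1 - gaussCdf (y j) := fun j => by
    rw [one_sub_cdf]; exact integral_nonneg fun t => (gaussD_pos t).le
  have hS0 : 0 ≤ S := Finset.sum_nonneg fun j _ => hp j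
  set F := ∑ j, hbar ν (x j) * (gaussCdf (x j) / gaussCdf (x j + 2 * (K / s))) with hF
  have hFabs : |F| ≤ C / c * (s ^ ν * (1 + S)) := by
    have h1 : ∀ j, |hbar ν (x j) * (gaussCdf (x j) / gaussCdf (x j + 2 * (K / s)))| ≤
        C / c * (s ^ ν * (1 - gaussCdf (y j)) + 1 / d) := by
      intro j
      have hΦ := gaussCdf_pos (x j)
      have hΦy := gaussCdf_pos (x j + 2 * (K / s))
      have hcy : c ≤ gaussCdf (x j + 2 * (K / s)) := gaussCdf_mono (by linarith [hx j])
      have e : hbar ν (x j) * (gaussCdf (x j) / gaussCdf (x j + 2 * (K / s))) =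
          hermiteR (ν - 1) (x j) * gaussD (x j) / gaussCdf (x j + 2 * (K / s)) := by
        unfold hbar; field_simp
      have ht := hT s hs1 (x j)
      rw [hexp] at ht
      rw [e, abs_div, abs_mul, abs_of_pos (gaussD_pos _), abs_of_pos hΦy]
      rw [div_mul_eq_mul_div]
      exact div_le_div₀ (mul_nonneg hC.le (add_nonneg (mul_nonneg (by positivity) (hp j)) (by positivity)))
        ht hc0 hcy
    calc |F| ≤ ∑ j, C / c * (s ^ ν * (1 - gaussCdf (y j)) + 1 / d) :=
          (Finset.abs_sum_le_sum_abs _ _).trans (Finset.sum_le_sum fun j _ => h1 j)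
      _ = C / c * (s ^ ν * S + 1) := by
          rw [← Finset.mul_sum, Finset.sum_add_distrib, ← Finset.mul_sum]
          congr 2
          simp [hd0.ne']
      _ ≤ C / c * (s ^ ν * (1 + S)) := by
          have : 1 ≤ s ^ ν := one_le_pow₀ hs1
          gcongr
          linarith
  have hG : ∏ k, gaussCdf (x k + 2 * (K / s)) ≤ Real.exp (-S) := by
    rw [hS, ← Finset.sum_neg_distrib, Real.exp_sum]
    refine Finset.prod_le_prod (fun k _ => gaussCdf_nonneg _) fun k _ => ?_
    have := Real.add_one_le_exp (-(1 - gaussCdf (y k)))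
    simp only [hy] at this ⊢
    linarith
  have hFβ : F ^ β ≤ (C / c * (s ^ ν * (1 + S))) ^ β :=
    (le_abs_self _).trans ((Real.abs_rpow_le_abs_rpow F β).trans
      (Real.rpow_le_rpow (abs_nonneg _) hFabs hβ.le))
  have hSβ : (1 + S) ^ β * Real.exp (-S) ≤ N.factorial * Real.exp 1 := by
    have h1 : (1 + S) ^ β ≤ (1 + S) ^ N := by
      rw [← Real.rpow_natCast]
      exact Real.rpow_le_rpow_of_exponent_le (by linarith) (Nat.le_ceil β)
    have h2 := Real.pow_div_factorial_le_exp (1 + S) (by positivity) N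
    rw [div_le_iff₀' (by positivity)] at h2
    calc (1 + S) ^ β * Real.exp (-S) ≤ (N.factorial * Real.exp (1 + S)) * Real.exp (-S) := by
          gcongr; exact h1.trans h2
      _ = N.factorial * Real.exp 1 := by
          rw [mul_assoc, ← Real.exp_add]; congr 2; ring
  have hsβ : (s ^ ν) ^ β = Real.log d ^ (β * ν / 2) := by
    have hL0 : 0 ≤ Real.log d := by linarith
    rw [hs, Real.sqrt_eq_rpow, ← Real.rpow_natCast, ← Real.rpow_mul hL0,
      ← Real.rpow_mul hL0]
    congr 1; ring
  calc F ^ β * ∏ k, gaussCdf (x k + 2 * (K / s))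
      ≤ (C / c * (s ^ ν * (1 + S))) ^ β * Real.exp (-S) :=
        mul_le_mul hFβ hG (Finset.prod_nonneg fun k _ => gaussCdf_nonneg _) (by positivity)
    _ = (C / c) ^ β * Real.log d ^ (β * ν / 2) * ((1 + S) ^ β * Real.exp (-S)) := by
        rw [Real.mul_rpow (by positivity) (by positivity),
          Real.mul_rpow (by positivity) (by positivity), hsβ]
        ring
    _ ≤ (C / c) ^ β * Real.log d ^ (β * ν / 2) * (N.factorial * Real.exp 1) := by
        refine mul_le_mul_of_nonneg_left hSβ ?_
        have : 0 ≤ Real.log d := by linarith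
        positivity
    _ = _ := by ring
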